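/- arXiv:2405.12848 — 8 statements merged into one kernel-verified Lean document; each statement's English description precedes it below -/
import Mathlib

section
/- Let (Ω, μ) be a measure space and let vᵃ, vᵇ, zᵃ, zᵇ : Ω → ℂ be (a.e.-strongly) measurable functions. Define S = |vᵃ|² − |vᵇ|² − |zᵃ|² + |zᵇ|² (pointwise). Then, with all norms interpreted as extended-nonnegative-real Lᵖ seminorms (so that no integrability assumptions are needed), ‖S‖_{L²} ≤ 2·‖zᵃ − zᵇ‖_{L^∞}·‖vᵇ − zᵇ‖_{L²} + (‖vᵃ‖_{L^∞} + ‖vᵇ‖_{L^∞} + ‖zᵃ − zᵇ‖_{L^∞})·‖vᵃ − vᵇ − zᵃ + zᵇ‖_{L²}. -/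
open MeasureTheory

/-- Cauchy–Schwarz and Hölder with exponents `(∞, p)` for the pointwise real inner product. -/
theorem eLpNorm_inner_le_eLpNorm_top_mul_eLpNorm {Ω E : Type*} [MeasurableSpace Ω]
    [NormedAddCommGroup E] [InnerProductSpace ℝ E] {μ : Measure Ω} (p : ENNReal)
    (f : Ω → E) {g : Ω → E} (hg : AEStronglyMeasurable g μ) :
    eLpNorm (fun x => inner ℝ (f x) (g x)) p μ ≤ eLpNorm f ⊤ μ * eLpNorm g p μ := by
  simpa using eLpNorm_le_eLpNorm_top_mul_eLpNorm p f hg (fun a b => inner ℝ a b) 1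
    (.of_forall fun x => by simpa using nnnorm_inner_le_nnnorm (𝕜 := ℝ) (f x) (g x))

theorem norm_sq_sub_norm_sq_sub_norm_sq_add_norm_sq {E : Type*} [NormedAddCommGroup E]
    [InnerProductSpace ℝ E] (a b c d : E) :
    ‖a‖ ^ 2 - ‖b‖ ^ 2 - ‖c‖ ^ 2 + ‖d‖ ^ 2 =
      2 * inner ℝ (c - d) (b - d) + inner ℝ (a + b + (c - d)) (a - b - c + d) := by
  simp only [← real_inner_self_eq_norm_sq, inner_add_left, inner_add_right, inner_sub_left,
    inner_sub_right]
  rw [real_inner_comm a b, real_inner_comm a c, real_inner_comm a d, real_inner_comm b c,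
    real_inner_comm b d, real_inner_comm c d]
  ring

/-- Lemma 3.2 of the paper (after Zouraris), for complex-valued measurable functions. -/
theorem eLpNorm_S_le {Ω : Type*} [MeasurableSpace Ω] (μ : Measure Ω)
    (va vb za zb : Ω → ℂ)
    (hva : AEStronglyMeasurable va μ) (hvb : AEStronglyMeasurable vb μ)
    (hza : AEStronglyMeasurable za μ) (hzb : AEStronglyMeasurable zb μ)
    (S : Ω → ℝ)
    (hS : S = fun x => ‖va x‖ ^ 2 - ‖vb x‖ ^ 2 - ‖za x‖ ^ 2 + ‖zb x‖ ^ 2) :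
    eLpNorm S 2 μ ≤
      2 * eLpNorm (za - zb) ⊤ μ * eLpNorm (vb - zb) 2 μ +
        (eLpNorm va ⊤ μ + eLpNorm vb ⊤ μ + eLpNorm (za - zb) ⊤ μ) *
          eLpNorm (va - vb - za + zb) 2 μ := by
  have he := hza.sub hzb
  have hw := hvb.sub hzb
  have hD := ((hva.sub hvb).sub hza).add hzb
  have hs := (hva.add hvb).add he
  have hdecomp : S = (2 : ℝ) • (fun x => inner ℝ ((za - zb) x) ((vb - zb) x)) +
      fun x => inner ℝ ((va + vb + (za - zb)) x) ((va - vb - za + zb) x) := by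
    rw [hS]
    funext x
    exact norm_sq_sub_norm_sq_sub_norm_sq_add_norm_sq (va x) (vb x) (za x) (zb x)
  have htop : eLpNorm (va + vb + (za - zb)) ⊤ μ ≤
      eLpNorm va ⊤ μ + eLpNorm vb ⊤ μ + eLpNorm (za - zb) ⊤ μ :=
    (eLpNorm_add_le (hva.add hvb) he le_top).trans
      (add_le_add_left (eLpNorm_add_le hva hvb le_top) _)
  rw [hdecomp]
  refine (eLpNorm_add_le ((he.inner (𝕜 := ℝ) hw).const_smul (2 : ℝ)) (hs.inner (𝕜 := ℝ) hD)
    one_le_two).trans (add_le_add ?_ ?_)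
  · have htwo : ‖(2 : ℝ)‖ₑ = 2 := by simp [Real.enorm_eq_ofReal]
    rw [eLpNorm_const_smul, mul_assoc, htwo]
    gcongr
    exact eLpNorm_inner_le_eLpNorm_top_mul_eLpNorm 2 _ hw
  · exact (eLpNorm_inner_le_eLpNorm_top_mul_eLpNorm 2 _ hD).trans (by gcongr)
end

section
/- The linear map S = I + i·c·A is invertible, and for the linear map B = S⁻¹ ∘ T one has ‖B v‖ ≤ ‖v‖ for every v ∈ E. -/
/-- For symmetric `A` and real `c`, the vectors `v` and `i c A v` are orthogonal over the reals. -/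
theorem LinearMap.IsSymmetric.norm_add_I_mul_smul_sq
    {E : Type*} [NormedAddCommGroup E] [InnerProductSpace ℂ E]
    {A : E →ₗ[ℂ] E} (hA : A.IsSymmetric) (c : ℝ) (v : E) :
    ‖v + (Complex.I * (c : ℂ)) • A v‖ ^ 2 = ‖v‖ ^ 2 + c ^ 2 * ‖A v‖ ^ 2 := by
  have him : (inner ℂ v (A v)).im = 0 := by
    have h : (starRingEnd ℂ) (inner ℂ v (A v)) = inner ℂ v (A v) := by
      rw [inner_conj_symm, hA v v]
    exact Complex.conj_eq_iff_im.mp h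
  rw [norm_add_sq (𝕜 := ℂ), inner_smul_right, norm_smul]
  simp [him, mul_pow]

open scoped ComplexInnerProductSpace in
/-- Lemma 3.5 (Operbdd), second part: `S = I + i c A` is invertible and
`B = S⁻¹ ∘ T`, with `T = I - i c A`, is a contraction. -/
theorem cayley_operator_contracts
    {E : Type*} [NormedAddCommGroup E] [InnerProductSpace ℂ E] [FiniteDimensional ℂ E]
    (A : E →ₗ[ℂ] E) (hA : ∀ v w : E, ⟪A v, w⟫ = ⟪v, A w⟫)
    (c : ℝ) (S T : E →ₗ[ℂ] E)
    (hS : S = LinearMap.id + (Complex.I * (c : ℂ)) • A)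
    (hT : T = LinearMap.id - (Complex.I * (c : ℂ)) • A) :
    ∃ Sinv : E →ₗ[ℂ] E,
      Sinv.comp S = LinearMap.id ∧ S.comp Sinv = LinearMap.id ∧
        ∀ v : E, ‖(Sinv.comp T) v‖ ≤ ‖v‖ := by
  have hsym : A.IsSymmetric := hA
  have hSn (v : E) : ‖S v‖ ^ 2 = ‖v‖ ^ 2 + c ^ 2 * ‖A v‖ ^ 2 := by
    simpa [hS] using hsym.norm_add_I_mul_smul_sq c v
  have hTn (v : E) : ‖T v‖ ^ 2 = ‖v‖ ^ 2 + c ^ 2 * ‖A v‖ ^ 2 := by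
    simpa [hT, sub_eq_add_neg] using hsym.norm_add_I_mul_smul_sq (-c) v
  have hST (v : E) : ‖T v‖ = ‖S v‖ := by
    rw [← sq_eq_sq₀ (norm_nonneg _) (norm_nonneg _), hTn, hSn]
  have hinj : Function.Injective S := by
    rw [injective_iff_map_eq_zero]
    intro v hv
    have h := hSn v
    rw [hv, norm_zero] at h
    have hv0 : ‖v‖ ^ 2 = 0 := by nlinarith [sq_nonneg ‖v‖, sq_nonneg (c * ‖A v‖)]
    simpa using hv0
  have hcomm (v : E) : S (T v) = T (S v) := by
    simp only [hS, hT, LinearMap.add_apply, LinearMap.sub_apply, LinearMap.id_apply,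
      LinearMap.smul_apply, map_add, map_sub, map_smul, smul_add, smul_sub]
    abel
  let e := LinearEquiv.ofInjectiveEndo S hinj
  have he (v : E) : S (e.symm v) = v := e.apply_symm_apply v
  refine ⟨e.symm, LinearMap.ext e.symm_apply_apply, LinearMap.ext he, fun v => ?_⟩
  have h : e.symm (T v) = T (e.symm v) := hinj (by rw [he, hcomm, he])
  change ‖e.symm (T v)‖ ≤ ‖v‖
  rw [h, hST, he]
end

section
/- Let R be a commutative ring in which 2 is invertible, let S be a unit of R, and set B = S⁻¹·(2 − S). Let M be the 2×2 matrix over R given by M = [[B − 1, B], [1, 0]]. Then for every natural number κ, M^κ = (1/2)·[[((−1)^κ + B^{κ+1})·S, ((−1)^{κ+1}·B + B^{κ+1})·S], [((−1)^{κ+1} + B^κ)·S, ((−1)^κ·B + B^κ)·S]]. -/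
/-- The matrix power identity (equation (Gkappa)) from the proof of Lemma 3.6. -/
theorem matrix_power_formula
    {R : Type*} [CommRing R] [Invertible (2 : R)]
    (S : Rˣ) (B : R) (hB : B = (↑S⁻¹ : R) * (2 - (S : R)))
    (M : Matrix (Fin 2) (Fin 2) R)
    (hM : M = !![B - 1, B; 1, 0]) :
    ∀ κ : ℕ,
      M ^ κ =
        (⅟(2 : R)) •
          !![((-1 : R) ^ κ + B ^ (κ + 1)) * (S : R),
              ((-1 : R) ^ (κ + 1) * B + B ^ (κ + 1)) * (S : R);
            ((-1 : R) ^ (κ + 1) + B ^ κ) * (S : R),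
              ((-1 : R) ^ κ * B + B ^ κ) * (S : R)] := by
  have hBS : (B + 1) * (S : R) = 2 := by
    have h := S.inv_mul
    rw [hB]
    linear_combination (2 - (S : R)) * h
  have h2 : ⅟(2 : R) * 2 = 1 := invOf_mul_self 2
  intro κ
  induction κ with
  | zero =>
    ext i j
    fin_cases i <;> fin_cases j <;> simp
    · linear_combination -h2 - ⅟(2 : R) * hBS
    · linear_combination -h2 - ⅟(2 : R) * hBS
  | succ κ ih =>
    rw [pow_succ, ih, hM]
    ext i j
    fin_cases i <;> fin_cases j <;> simp [Matrix.mul_apply, Fin.sum_univ_two] <;> ring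
end

section
/- Assume S = I + i·c·A is invertible and set B = S⁻¹ ∘ T. Let (yₙ)ₙ≥1 and (Γₙ)ₙ≥3 be sequences in E, and let n ≥ 2 be such that for every m with 2 ≤ m ≤ n the recurrence y_{m+1} = (B − I) y_m + B y_{m−1} + S⁻¹ Γ_{m+1} holds. Then for i = n and i = n + 1 one has the explicit formula y_i = (1/2)·[(−1)^i·I + B^{i−1}]·S y₂ + (1/2)·[(−1)^{i−1}·B + B^{i−1}]·S y₁ + (1/2)·∑_{l=2}^{n} [(−1)^{i−l+1}·I + B^{i−l}]·Γ_{l+1}. -/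
/-- The solution of `p (k + 2) = (b - 1) * p (k + 1) + b * p k` with `p 0 = 0` and
`p 1 = 1 + b`. -/
def twoLevelKernel {R : Type*} [Ring R] (b : R) (k : ℕ) : R := b ^ k - (-1) ^ k

@[simp]
theorem twoLevelKernel_zero {R : Type*} [Ring R] (b : R) : twoLevelKernel b 0 = 0 := by
  simp [twoLevelKernel]

@[simp]
theorem twoLevelKernel_one {R : Type*} [Ring R] (b : R) : twoLevelKernel b 1 = 1 + b := by
  simp [twoLevelKernel, add_comm]

theorem twoLevelKernel_add_two {R : Type*} [Ring R] (b : R) (k : ℕ) :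
    twoLevelKernel b (k + 2) = (b - 1) * twoLevelKernel b (k + 1) + b * twoLevelKernel b k := by
  simp only [twoLevelKernel, pow_succ' b, pow_succ (-1 : R)]
  noncomm_ring

/-- Duhamel formula for a two-level recurrence whose data lie in the range of `1 + b`. -/
theorem eq_twoLevelKernel_smul_add_sum {R M : Type*} [Ring R] [AddCommGroup M] [Module R M]
    (b : R) (x g : ℕ → M) (u v : M) (N : ℕ) (h0 : x 0 = (1 + b) • u) (h1 : x 1 = (1 + b) • v)
    (h : ∀ k < N, x (k + 2) = (b - 1) • x (k + 1) + b • x k + (1 + b) • g k) (k : ℕ)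
    (hk : k ≤ N) :
    x (k + 1) = twoLevelKernel b (k + 1) • v + (b * twoLevelKernel b k) • u +
      ∑ j ∈ Finset.range k, twoLevelKernel b (k - j) • g j := by
  induction k using Nat.twoStepInduction with
  | zero => simp [h1]
  | one =>
    rw [h 0 hk, h0, h1, twoLevelKernel_add_two b 0]
    simp [mul_smul]
  | more k ih ih' =>
    rw [h (k + 1) hk, ih (by omega), ih' (by omega), Finset.sum_range_succ _ (k + 1)]
    have hs : ∑ j ∈ Finset.range (k + 1), twoLevelKernel b (k + 2 - j) • g j =
        (b - 1) • ∑ j ∈ Finset.range (k + 1), twoLevelKernel b (k + 1 - j) • g j +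
          b • ∑ j ∈ Finset.range k, twoLevelKernel b (k - j) • g j := by
      have hext : ∑ j ∈ Finset.range k, twoLevelKernel b (k - j) • g j =
          ∑ j ∈ Finset.range (k + 1), twoLevelKernel b (k - j) • g j := by
        simp [Finset.sum_range_succ]
      rw [hext, Finset.smul_sum, Finset.smul_sum, ← Finset.sum_add_distrib]
      refine Finset.sum_congr rfl fun j hj => ?_
      have hj' : j ≤ k := Finset.mem_range_succ_iff.mp hj
      rw [Nat.sub_add_comm hj', Nat.sub_add_comm hj', twoLevelKernel_add_two, add_smul,
        mul_smul, mul_smul]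
    have hb : b * twoLevelKernel b (k + 2) =
        (b - 1) * (b * twoLevelKernel b (k + 1)) + b * (b * twoLevelKernel b k) := by
      rw [twoLevelKernel_add_two]
      noncomm_ring
    rw [hs, hb, twoLevelKernel_add_two b (k + 1)]
    simp only [show k + 2 - (k + 1) = 1 by omega, twoLevelKernel_one,
      add_smul, mul_smul, smul_add]
    abel

theorem neg_one_pow_smul_one {K R : Type*} [Ring K] [Ring R] [Module K R] (k : ℕ) :
    (-1 : K) ^ k • (1 : R) = (-1) ^ k := by
  rcases Nat.even_or_odd k with h | h <;> simp [h.neg_one_pow]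

open scoped ComplexInnerProductSpace in
open Finset in
/-- Explicit two-level solution formula (equation (lemcond2)) from the proof of
Lemma 3.6 of the paper. -/
theorem two_level_explicit_formula
    {E : Type*} [NormedAddCommGroup E] [InnerProductSpace ℂ E] [FiniteDimensional ℂ E]
    (A : E →ₗ[ℂ] E) (hA : ∀ v w : E, ⟪A v, w⟫ = ⟪v, A w⟫)
    (c : ℝ) (S T : E →ₗ[ℂ] E)
    (hS : S = LinearMap.id + (Complex.I * (c : ℂ)) • A)
    (hT : T = LinearMap.id - (Complex.I * (c : ℂ)) • A)
    (Sinv : E →ₗ[ℂ] E)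
    (hinv₁ : Sinv.comp S = LinearMap.id) (hinv₂ : S.comp Sinv = LinearMap.id)
    (B : E →ₗ[ℂ] E) (hB : B = Sinv.comp T)
    (y Γ : ℕ → E) (n : ℕ) (hn : 2 ≤ n)
    (hrec : ∀ m : ℕ, 2 ≤ m → m ≤ n →
      y (m + 1) = ((B - LinearMap.id : E →ₗ[ℂ] E) (y m)) + B (y (m - 1)) + Sinv (Γ (m + 1))) :
    ∀ i : ℕ, (i = n ∨ i = n + 1) →
      y i =
        (2 : ℂ)⁻¹ • (((-1 : ℂ) ^ i • (1 : E →ₗ[ℂ] E) + B ^ (i - 1)) (S (y 2))) +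
          (2 : ℂ)⁻¹ • (((-1 : ℂ) ^ (i - 1) • B + B ^ (i - 1)) (S (y 1))) +
          (2 : ℂ)⁻¹ •
            ∑ l ∈ Icc 2 n,
              (((-1 : ℂ) ^ (i - l + 1) • (1 : E →ₗ[ℂ] E) + B ^ (i - l)) (Γ (l + 1))) := by
  have hsum : S + T = (2 : ℂ) • LinearMap.id := by rw [hS, hT]; module
  have hSinv : ∀ w, Sinv w = (1 + B) ((2 : ℂ)⁻¹ • w) := by
    intro w
    have hcomm : ∀ v, T (S v) = S (T v) := by
      intro v
      simp only [hS, hT, LinearMap.add_apply, LinearMap.sub_apply, LinearMap.smul_apply,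
        LinearMap.id_apply, map_add, map_sub, map_smul]
      module
    have hw : S (Sinv w) = w := LinearMap.congr_fun hinv₂ w
    have hl : ∀ v, Sinv (S v) = v := LinearMap.congr_fun hinv₁
    have hBw : B w = T (Sinv w) := by
      rw [hB, LinearMap.comp_apply]
      nth_rewrite 1 [← hw]
      rw [hcomm, hl]
    have h2 : w + B w = (2 : ℂ) • Sinv w := by
      rw [hBw]
      nth_rewrite 1 [← hw]
      exact LinearMap.congr_fun hsum (Sinv w)
    rw [map_smul, LinearMap.add_apply, Module.End.one_apply, h2, smul_smul]
    norm_num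
  have hrange : ∀ v, v = (1 + B) ((2 : ℂ)⁻¹ • S v) := fun v => by
    rw [← hSinv]; exact (LinearMap.congr_fun hinv₁ v).symm
  have key := eq_twoLevelKernel_smul_add_sum (R := Module.End ℂ E) B (fun k => y (k + 1))
    (fun k => (2 : ℂ)⁻¹ • Γ (k + 3)) ((2 : ℂ)⁻¹ • S (y 1)) ((2 : ℂ)⁻¹ • S (y 2)) (n - 1)
    (hrange _) (hrange _) (fun k hk => by
      have := hrec (k + 2) (by omega) (by omega)
      rw [hSinv] at this
      exact this)
  have hform : ∀ k ≤ n - 1, y (k + 2) = (2 : ℂ)⁻¹ •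
        (((-1 : ℂ) ^ (k + 2) • (1 : E →ₗ[ℂ] E) + B ^ (k + 1)) (S (y 2))) +
      (2 : ℂ)⁻¹ • (((-1 : ℂ) ^ (k + 1) • B + B ^ (k + 1)) (S (y 1))) +
      (2 : ℂ)⁻¹ • ∑ j ∈ range k,
        (((-1 : ℂ) ^ (k - j + 1) • (1 : E →ₗ[ℂ] E) + B ^ (k - j)) (Γ (j + 3))) := by
    intro k hk
    have hker : ∀ m, (-1 : ℂ) ^ (m + 1) • (1 : E →ₗ[ℂ] E) + B ^ m = twoLevelKernel B m := by
      intro m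
      rw [twoLevelKernel, ← neg_one_pow_smul_one (K := ℂ) (R := E →ₗ[ℂ] E), pow_succ]
      module
    have hker' : (-1 : ℂ) ^ (k + 1) • B + B ^ (k + 1) = B * twoLevelKernel B k := by
      rw [← hker, mul_add, mul_smul_comm, mul_one, pow_succ' B]
    rw [key k hk, hker (k + 1), hker', smul_sum]
    simp only [hker, Module.End.smul_def, map_smul]
  have hIcc : ∀ (f : ℕ → E) (k : ℕ), ∑ l ∈ Icc 2 (k + 1), f l = ∑ j ∈ range k, f (j + 2) := by
    intro f k
    rw [range_eq_Ico, sum_Ico_add']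
    rfl
  obtain ⟨k, rfl⟩ := Nat.exists_eq_add_of_le' hn
  rintro i (rfl | rfl)
  · rw [hform k (by omega), hIcc _ (k + 1), sum_range_succ]
    simp
  · rw [hform (k + 1) (by omega), hIcc _ (k + 1)]
    simp
end

section
/- Assume S = I + i·c·A is invertible and set B = S⁻¹ ∘ T. Let (yₙ)ₙ≥1 and (Γₙ)ₙ≥3 be sequences in E, and let n ≥ 2 be such that for every m with 2 ≤ m ≤ n the recurrence y_{m+1} = (B − I) y_m + B y_{m−1} + S⁻¹ Γ_{m+1} holds. Then ‖y_{n+1}‖ + ‖y_n‖ ≤ 2·‖S y₂‖ + 2·‖S y₁‖ + 2·∑_{l=2}^{n} ‖Γ_{l+1}‖. -/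
theorem LinearMap.IsSymmetric.norm_add_I_mul_smul_eq_norm_sub
    {E : Type*} [NormedAddCommGroup E] [InnerProductSpace ℂ E]
    {A : E →ₗ[ℂ] E} (hA : A.IsSymmetric) (c : ℝ) (v : E) :
    ‖v + (Complex.I * (c : ℂ)) • A v‖ = ‖v - (Complex.I * (c : ℂ)) • A v‖ := by
  have him : (inner ℂ v (A v)).im = 0 := hA.im_inner_self_apply v
  have hre : RCLike.re (inner ℂ v ((Complex.I * (c : ℂ)) • A v)) = 0 := by
    simp [him]
  rw [← sq_eq_sq₀ (norm_nonneg _) (norm_nonneg _), @norm_add_sq ℂ, @norm_sub_sq ℂ, hre]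
  ring

/-- A real sequence whose increments are controlled by `g` is controlled by the sum of `g`. -/
theorem le_add_sum_Icc_of_le_add {f g : ℕ → ℝ} {n : ℕ} (hn : 2 ≤ n)
    (h : ∀ m, 2 ≤ m → m ≤ n → f (m + 1) ≤ f m + g m) :
    f (n + 1) ≤ f 2 + ∑ l ∈ Finset.Icc 2 n, g l := by
  induction n, hn using Nat.le_induction with
  | base => simpa using h 2 le_rfl le_rfl
  | succ k hk ih =>
    rw [Finset.sum_Icc_succ_top (by omega)]
    have h₁ := ih fun m hm hmk => h m hm (by omega)
    have h₂ := h (k + 1) (by omega) le_rfl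
    linarith


open scoped ComplexInnerProductSpace in
open Finset in
/-- Lemma 3.6 (ZourariResult) of the paper. -/
theorem two_level_stability_bound
    {E : Type*} [NormedAddCommGroup E] [InnerProductSpace ℂ E] [FiniteDimensional ℂ E]
    (A : E →ₗ[ℂ] E) (hA : ∀ v w : E, ⟪A v, w⟫ = ⟪v, A w⟫)
    (c : ℝ) (S T : E →ₗ[ℂ] E)
    (hS : S = LinearMap.id + (Complex.I * (c : ℂ)) • A)
    (hT : T = LinearMap.id - (Complex.I * (c : ℂ)) • A)
    (Sinv : E →ₗ[ℂ] E)
    (hinv₁ : Sinv.comp S = LinearMap.id) (hinv₂ : S.comp Sinv = LinearMap.id)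
    (B : E →ₗ[ℂ] E) (hB : B = Sinv.comp T)
    (y Γ : ℕ → E) (n : ℕ) (hn : 2 ≤ n)
    (hrec : ∀ m : ℕ, 2 ≤ m → m ≤ n →
      y (m + 1) = ((B - LinearMap.id : E →ₗ[ℂ] E) (y m)) + B (y (m - 1)) + Sinv (Γ (m + 1))) :
    ‖y (n + 1)‖ + ‖y n‖ ≤
      2 * ‖S (y 2)‖ + 2 * ‖S (y 1)‖ + 2 * ∑ l ∈ Icc 2 n, ‖Γ (l + 1)‖ := by
  have hST : ∀ v, ‖S v‖ = ‖T v‖ := by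
    intro v
    have hsymm : A.IsSymmetric := hA
    simpa [hS, hT] using hsymm.norm_add_I_mul_smul_eq_norm_sub c v
  have hadd : ∀ v, S v + T v = (2 : ℝ) • v := by
    intro v
    simp only [hS, hT, LinearMap.add_apply, LinearMap.sub_apply, LinearMap.id_apply, two_smul]
    abel
  have hSSinv : ∀ v, S (Sinv v) = v := fun v => LinearMap.congr_fun hinv₂ v
  have hSrec : ∀ m, 2 ≤ m → m ≤ n →
      S (y (m + 1)) = T (y m) - S (y m) + T (y (m - 1)) + Γ (m + 1) := by
    intro m hm hmn
    simp [hrec m hm hmn, hB, hSSinv]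
  -- The two first-order factors of the recurrence are each stable in the norm `‖S ·‖`.
  have hsum := le_add_sum_Icc_of_le_add (f := fun m => ‖S (y m + y (m - 1))‖)
    (g := fun m => ‖Γ (m + 1)‖) hn (by
      intro m hm hmn
      have h : S (y (m + 1) + y m) = T (y m + y (m - 1)) + Γ (m + 1) := by
        rw [map_add, map_add, hSrec m hm hmn]
        abel
      simp only [Nat.add_sub_cancel]
      rw [h, hST (y m + y (m - 1))]
      exact norm_add_le _ _)
  have hdiff := le_add_sum_Icc_of_le_add (f := fun m => ‖S (y m) - T (y (m - 1))‖)
    (g := fun m => ‖Γ (m + 1)‖) hn (by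
      intro m hm hmn
      have h : S (y (m + 1)) - T (y m) = Γ (m + 1) - (S (y m) - T (y (m - 1))) := by
        rw [hSrec m hm hmn]
        abel
      simp only [Nat.add_sub_cancel]
      rw [h, add_comm ‖S (y m) - T (y (m - 1))‖]
      exact norm_sub_le _ _)
  simp only [Nat.add_sub_cancel, Nat.reduceSub] at hsum hdiff
  have hsum₀ : ‖S (y 2 + y 1)‖ ≤ ‖S (y 2)‖ + ‖S (y 1)‖ := by
    rw [map_add]
    exact norm_add_le _ _
  have hdiff₀ : ‖S (y 2) - T (y 1)‖ ≤ ‖S (y 2)‖ + ‖S (y 1)‖ := by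
    rw [hST (y 1)]
    exact norm_sub_le _ _
  have hy : 2 * ‖y n‖ ≤ ‖S (y (n + 1) + y n)‖ + ‖S (y (n + 1)) - T (y n)‖ := by
    have h : (2 : ℝ) • y n = S (y (n + 1) + y n) - (S (y (n + 1)) - T (y n)) := by
      rw [← hadd, map_add]
      abel
    calc 2 * ‖y n‖ = ‖(2 : ℝ) • y n‖ := by simp [norm_smul]
      _ ≤ _ := by
        rw [h]
        exact norm_sub_le _ _
  have hy' : 2 * ‖y (n + 1)‖ ≤ ‖S (y (n + 1) + y n)‖ + ‖S (y (n + 1)) - T (y n)‖ := by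
    have h : (2 : ℝ) • y (n + 1) = T (y (n + 1) + y n) + (S (y (n + 1)) - T (y n)) := by
      rw [← hadd, map_add]
      abel
    calc 2 * ‖y (n + 1)‖ = ‖(2 : ℝ) • y (n + 1)‖ := by simp [norm_smul]
      _ ≤ _ := by
        rw [h, hST (y (n + 1) + y n)]
        exact norm_add_le _ _
  linarith
end

section
/- Let E be a real normed vector space, let u : ℝ → E be four times continuously differentiable, let t ∈ ℝ, τ > 0, and let M ≥ 0 be such that ‖u⁗(s)‖ ≤ M for all s ∈ [t − τ, t + τ]. Then ‖u'(t + τ/2) − u'(t − τ/2) − (u(t + τ) − 2·u(t) + u(t − τ))/τ‖ ≤ (1/8)·τ³·M. -/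
/-- If `f a = 0` and the derivative of `f` is bounded in norm by `C * (x - a) ^ n` on `[a, b]`,
then `f` is bounded in norm by `C / (n + 1) * (x - a) ^ (n + 1)` there. -/
theorem norm_le_of_norm_deriv_le_mul_pow
    {E : Type*} [NormedAddCommGroup E] [NormedSpace ℝ E]
    {f f' : ℝ → E} {a b C : ℝ} {n : ℕ} (hf : ∀ x, HasDerivAt f (f' x) x) (hfa : f a = 0)
    (bound : ∀ x ∈ Set.Icc a b, ‖f' x‖ ≤ C * (x - a) ^ n) :
    ∀ x ∈ Set.Icc a b, ‖f x‖ ≤ C / (n + 1) * (x - a) ^ (n + 1) := by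
  intro x hx
  refine image_norm_le_of_norm_deriv_right_le_deriv_boundary
    (B := fun x => C / (n + 1) * (x - a) ^ (n + 1)) (B' := fun x => C * (x - a) ^ n)
    (fun y _ => (hf y).continuousAt.continuousWithinAt) (fun y _ => (hf y).hasDerivWithinAt)
    (by simp [hfa]) (fun y => ?_) (fun y hy => bound y (Set.Ico_subset_Icc_self hy)) hx
  have h := (((hasDerivAt_id y).sub_const a).pow (n + 1)).const_mul (C / (n + 1))
  refine HasDerivAt.congr_deriv h ?_
  have : (n : ℝ) + 1 ≠ 0 := by positivity
  simp
  field_simp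

theorem ContDiff.hasDerivAt_iteratedDeriv
    {E : Type*} [NormedAddCommGroup E] [NormedSpace ℝ E] {u : ℝ → E} {n : WithTop ℕ∞}
    (hu : ContDiff ℝ n u) {k : ℕ} (hk : (k : WithTop ℕ∞) < n) (x : ℝ) :
    HasDerivAt (iteratedDeriv k u) (iteratedDeriv (k + 1) u x) x := by
  rw [iteratedDeriv_succ]
  exact (hu.differentiable_iteratedDeriv k hk x).hasDerivAt

/-- Consistency estimate (appendEq3): the central difference quotient of step τ
approximates the central first-derivative difference of step τ/2 to third order. -/
theorem central_difference_consistency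
    {E : Type*} [NormedAddCommGroup E] [NormedSpace ℝ E]
    (u : ℝ → E) (hu : ContDiff ℝ 4 u)
    (t τ : ℝ) (hτ : 0 < τ) (M : ℝ) (hM : 0 ≤ M)
    (hbound : ∀ s ∈ Set.Icc (t - τ) (t + τ), ‖iteratedDeriv 4 u s‖ ≤ M) :
    ‖deriv u (t + τ / 2) - deriv u (t - τ / 2) -
        τ⁻¹ • (u (t + τ) - (2 : ℝ) • u t + u (t - τ))‖ ≤ (1 / 8) * τ ^ 3 * M := by
  have hd : ∀ k < 4, ∀ x, HasDerivAt (iteratedDeriv k u) (iteratedDeriv (k + 1) u x) x :=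
    fun k hk x => hu.hasDerivAt_iteratedDeriv (by exact_mod_cast hk) x
  have hadd : ∀ k < 4, ∀ s, HasDerivAt (fun s => iteratedDeriv k u (t + s))
      (iteratedDeriv (k + 1) u (t + s)) s := fun k hk s => (hd k hk (t + s)).comp_const_add t s
  have hsub : ∀ k < 4, ∀ s, HasDerivAt (fun s => iteratedDeriv k u (t - s))
      (-iteratedDeriv (k + 1) u (t - s)) s := fun k hk s => (hd k hk (t - s)).comp_const_sub t s
  let D := fun k => iteratedDeriv k u
  -- the second difference minus its quadratic Taylor polynomial, and its derivatives
  let F : ℝ → E := fun s => D 0 (t + s) - (2 : ℝ) • D 0 t + D 0 (t - s) - s ^ 2 • D 2 t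
  let F₁ : ℝ → E := fun s => D 1 (t + s) - D 1 (t - s) - (2 * s) • D 2 t
  let F₂ : ℝ → E := fun s => D 2 (t + s) + D 2 (t - s) - (2 : ℝ) • D 2 t
  let F₃ : ℝ → E := fun s => D 3 (t + s) - D 3 (t - s)
  let F₄ : ℝ → E := fun s => D 4 (t + s) + D 4 (t - s)
  have hF : ∀ s, HasDerivAt F (F₁ s) s := fun s => by
    have h := (((hadd 0 (by simp) s).sub_const ((2 : ℝ) • D 0 t)).add (hsub 0 (by simp) s)).sub
      ((hasDerivAt_pow 2 s).smul_const (D 2 t))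
    refine HasDerivAt.congr_deriv h ?_
    simp [F₁, D, sub_eq_add_neg]
  have hF₁ : ∀ s, HasDerivAt F₁ (F₂ s) s := fun s => by
    have h := ((hadd 1 (by simp) s).sub (hsub 1 (by simp) s)).sub
      (((hasDerivAt_id s).const_mul 2).smul_const (D 2 t))
    refine HasDerivAt.congr_deriv h ?_
    simp [F₂, D]
  have hF₂ : ∀ s, HasDerivAt F₂ (F₃ s) s := fun s => by
    have h := ((hadd 2 (by simp) s).add (hsub 2 (by simp) s)).sub_const ((2 : ℝ) • D 2 t)
    refine HasDerivAt.congr_deriv h ?_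
    simp [F₃, D, sub_eq_add_neg]
  have hF₃ : ∀ s, HasDerivAt F₃ (F₄ s) s := fun s => by
    have h := (hadd 3 (by simp) s).sub (hsub 3 (by simp) s)
    refine HasDerivAt.congr_deriv h ?_
    simp [F₄, D]
  have b₄ : ∀ s ∈ Set.Icc 0 τ, ‖F₄ s‖ ≤ 2 * M * (s - 0) ^ 0 := fun s hs => by
    have h₁ := hbound (t + s) ⟨by linarith [hs.1], by linarith [hs.2]⟩
    have h₂ := hbound (t - s) ⟨by linarith [hs.2], by linarith [hs.1]⟩
    have h₃ : ‖F₄ s‖ ≤ _ := norm_add_le _ _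
    simp only [D] at h₃
    linarith
  have b₃ := norm_le_of_norm_deriv_le_mul_pow hF₃ (by simp [F₃]) b₄
  have b₂ := norm_le_of_norm_deriv_le_mul_pow hF₂ (by simp [F₂, two_smul]) b₃
  have b₁ := norm_le_of_norm_deriv_le_mul_pow hF₁ (by simp [F₁]) b₂
  have b₀ := norm_le_of_norm_deriv_le_mul_pow hF (by simp [F, two_smul]) b₁
  have key : deriv u (t + τ / 2) - deriv u (t - τ / 2) -
      τ⁻¹ • (u (t + τ) - (2 : ℝ) • u t + u (t - τ)) = F₁ (τ / 2) - τ⁻¹ • F τ := by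
    simp only [F₁, F, D, iteratedDeriv_one, iteratedDeriv_zero]
    match_scalars <;> field_simp <;> ring
  have hb₁ := b₁ (τ / 2) ⟨by positivity, by linarith⟩
  have hb₀ := b₀ τ ⟨hτ.le, le_rfl⟩
  rw [key]
  calc ‖F₁ (τ / 2) - τ⁻¹ • F τ‖ ≤ ‖F₁ (τ / 2)‖ + τ⁻¹ * ‖F τ‖ := by
        refine (norm_sub_le _ _).trans_eq ?_
        rw [norm_smul, Real.norm_of_nonneg (by positivity)]
    _ ≤ _ := add_le_add hb₁ (mul_le_mul_of_nonneg_left hb₀ (by positivity))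
    _ = (1 / 8) * τ ^ 3 * M := by
        push_cast
        field_simp
        ring
end

section
/- Let E be a real normed vector space, let f : ℝ → E be three times continuously differentiable, let t ∈ ℝ, τ > 0, and let M ≥ 0 be such that ‖f'''(s)‖ ≤ M for all s ∈ [t − 3τ/2, t + τ/2]. Then ‖f(t + τ/2) − 2·f(t) + 2·f(t − τ) − f(t − 3τ/2)‖ ≤ (11/12)·τ³·M. -/
lemma norm_le_of_norm_deriv_le_mul_pow_s11 {E : Type*} [NormedAddCommGroup E] [NormedSpace ℝ E]
    {g g' : ℝ → E} {a K : ℝ} (n : ℕ) (hg : ∀ s, HasDerivAt g (g' s) s) (hg0 : g 0 = 0)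
    (hg' : ∀ s ∈ Set.Icc 0 a, ‖g' s‖ ≤ K * s ^ n) :
    ∀ s ∈ Set.Icc 0 a, ‖g s‖ ≤ K / (n + 1) * s ^ (n + 1) := by
  have hB : ∀ s : ℝ, HasDerivAt (fun s : ℝ => K / (n + 1) * s ^ (n + 1)) (K * s ^ n) s := by
    intro s
    refine ((hasDerivAt_pow (n + 1) s).const_mul (K / (n + 1))).congr_deriv ?_
    have : (n : ℝ) + 1 ≠ 0 := by positivity
    push_cast
    field_simp
  intro s hs
  exact image_norm_le_of_norm_deriv_right_le_deriv_boundary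
    (fun x _ => (hg x).continuousAt.continuousWithinAt) (fun x _ => (hg x).hasDerivWithinAt)
    (by simp [hg0]) hB (fun x hx => hg' x (Set.Ico_subset_Icc_self hx)) hs

lemma hasDerivAt_four_point_combination {E : Type*} [NormedAddCommGroup E] [NormedSpace ℝ E]
    {f f' : ℝ → E} (hf : ∀ s, HasDerivAt f (f' s) s) (c p q r w s : ℝ) :
    HasDerivAt (fun s => p • f (c + 2 * s) + q • f (c + s) + r • f (c - s) + w • f (c - 2 * s))
      ((p * 2) • f' (c + 2 * s) + q • f' (c + s) + (-r) • f' (c - s) +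
        (-(w * 2)) • f' (c - 2 * s)) s := by
  have hmul : HasDerivAt (fun s : ℝ => 2 * s) 2 s := by
    simpa using (hasDerivAt_id s).const_mul (2 : ℝ)
  have h1 := ((hf (c + 2 * s)).scomp s (hmul.const_add c)).const_smul p
  have h2 := ((hf (c + s)).scomp s ((hasDerivAt_id s).const_add c)).const_smul q
  have h3 := ((hf (c - s)).scomp s ((hasDerivAt_id s).const_sub c)).const_smul r
  have h4 := ((hf (c - 2 * s)).scomp s (hmul.const_sub c)).const_smul w
  refine (((h1.add h2).add h3).add h4).congr_deriv ?_
  module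

/-- Consistency estimate (S3psi+): the four-point combination
`f(t+τ/2) − 2f(t) + 2f(t−τ) − f(t−3τ/2)` is of third order in τ. -/
theorem four_point_combination_estimate
    {E : Type*} [NormedAddCommGroup E] [NormedSpace ℝ E]
    (f : ℝ → E) (hf : ContDiff ℝ 3 f)
    (t τ : ℝ) (hτ : 0 < τ) (M : ℝ) (hM : 0 ≤ M)
    (hbound : ∀ s ∈ Set.Icc (t - 3 * τ / 2) (t + τ / 2), ‖iteratedDeriv 3 f s‖ ≤ M) :
    ‖f (t + τ / 2) - (2 : ℝ) • f t + (2 : ℝ) • f (t - τ) - f (t - 3 * τ / 2)‖ ≤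
      (11 / 12) * τ ^ 3 * M := by
  have hD : ∀ k < 3, ∀ s, HasDerivAt (iteratedDeriv k f) (iteratedDeriv (k + 1) f s) s := by
    intro k hk s
    rw [iteratedDeriv_succ]
    exact (hf.differentiable_iteratedDeriv k (by exact_mod_cast hk) s).hasDerivAt
  set c : ℝ := t - τ / 2 with hc
  have h0 := hasDerivAt_four_point_combination (hD 0 (by norm_num)) c 1 (-2) 2 (-1)
  have h1 := hasDerivAt_four_point_combination (hD 1 (by norm_num)) c (1 * 2) (-2) (-2) (-(-1 * 2))
  have h2 := hasDerivAt_four_point_combination (hD 2 (by norm_num)) c (1 * 2 * 2) (-2) (-(-2))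
    (-(-(-1 * 2) * 2))
  have b3 := norm_le_of_norm_deriv_le_mul_pow_s11 (a := τ / 2) (K := 20 * M) 0 h2
    (by simp only [mul_zero, add_zero, sub_zero]; module) (by
      intro s hs
      obtain ⟨hs0, hs1⟩ := hs
      have e : ∀ (p x : ℝ), x ∈ Set.Icc (t - 3 * τ / 2) (t + τ / 2) →
          ‖p • iteratedDeriv (2 + 1) f x‖ ≤ |p| * M := fun p x hx => by
        rw [norm_smul, Real.norm_eq_abs]
        exact mul_le_mul_of_nonneg_left (hbound x hx) (abs_nonneg p)
      refine norm_add₄_le.trans ((add_le_add (add_le_add (add_le_add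
        (e _ _ ⟨?_, ?_⟩) (e _ _ ⟨?_, ?_⟩)) (e _ _ ⟨?_, ?_⟩)) (e _ _ ⟨?_, ?_⟩)).trans ?_)
      on_goal 9 => norm_num; linarith
      all_goals linarith)
  have b2 := norm_le_of_norm_deriv_le_mul_pow_s11 _ h1
    (by simp only [mul_zero, add_zero, sub_zero]; module) b3
  have b1 := norm_le_of_norm_deriv_le_mul_pow_s11 _ h0
    (by simp only [mul_zero, add_zero, sub_zero]; module) b2 (τ / 2) ⟨by linarith, le_rfl⟩
  have e1 : c + 2 * (τ / 2) = t + τ / 2 := by rw [hc]; ring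
  have e2 : c + τ / 2 = t := by rw [hc]; ring
  have e3 : c - τ / 2 = t - τ := by rw [hc]; ring
  have e4 : c - 2 * (τ / 2) = t - 3 * τ / 2 := by rw [hc]; ring
  rw [e1, e2, e3, e4, iteratedDeriv_zero] at b1
  have hpos : 0 ≤ τ ^ 3 * M := by positivity
  calc _ = _ := by congr 1; module
    _ ≤ _ := b1
    _ ≤ _ := by norm_num; linarith
end

section
/- Let E be a real normed vector space, let u : ℝ → E be twice continuously differentiable, let b ≤ a be real numbers, τ ≥ 0, and let M ≥ 0 be such that ‖u''(s)‖ ≤ M for all s ∈ [b, a + τ]. Then ‖u(a + τ) − u(a) − u(b + τ) + u(b)‖ ≤ τ·(a − b)·M. -/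
/-- Double-difference estimate (core of (appendEq6)). -/
theorem double_difference_estimate
    {E : Type*} [NormedAddCommGroup E] [NormedSpace ℝ E]
    (u : ℝ → E) (hu : ContDiff ℝ 2 u)
    (a b τ : ℝ) (hba : b ≤ a) (hτ : 0 ≤ τ) (M : ℝ) (hM : 0 ≤ M)
    (hbound : ∀ s ∈ Set.Icc b (a + τ), ‖iteratedDeriv 2 u s‖ ≤ M) :
    ‖u (a + τ) - u a - u (b + τ) + u b‖ ≤ τ * (a - b) * M := by
  have hu₁ : ∀ x, HasDerivAt u (deriv u x) x := fun x =>
    (hu.differentiable (by norm_num) x).hasDerivAt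
  have hu₂ : ∀ x, HasDerivAt (deriv u) (iteratedDeriv 2 u x) x := by
    intro x
    have h := (hu.differentiable_iteratedDeriv 1 (by norm_num) x).hasDerivAt
    rwa [← iteratedDeriv_succ, iteratedDeriv_one] at h
  have hderiv : ∀ s ∈ Set.Ico 0 τ, ‖deriv u (a + s) - deriv u (b + s)‖ ≤ M * (a - b) := by
    intro s hs
    have h := norm_image_sub_le_of_norm_deriv_le_segment' (a := b + s) (b := a + s)
      (fun x _ => (hu₂ x).hasDerivWithinAt)
      (fun x hx => hbound x ⟨by linarith [hx.1, hs.1], by linarith [hx.2, hs.2]⟩)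
      (a + s) ⟨by linarith, le_rfl⟩
    simpa using h
  have h := norm_image_sub_le_of_norm_deriv_le_segment'
    (f := fun s => u (a + s) - u (b + s))
    (fun s _ => (((hu₁ (a + s)).comp_const_add a s).sub
      ((hu₁ (b + s)).comp_const_add b s)).hasDerivWithinAt)
    hderiv τ ⟨hτ, le_rfl⟩
  calc ‖u (a + τ) - u a - u (b + τ) + u b‖
      = ‖u (a + τ) - u (b + τ) - (u (a + 0) - u (b + 0))‖ := by
        rw [add_zero, add_zero]; congr 1; abel
    _ ≤ M * (a - b) * (τ - 0) := h
    _ = τ * (a - b) * M := by ring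
end
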